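/- arXiv:2308.15931 — 9 statements merged into one kernel-verified Lean document; each statement's English description precedes it below -/
import Mathlib

section
/- For every t in the open interval (0, t_max), the quantity ((o_x − x̃(t))² + (o_y − ỹ(t))²)·Φ′(t) equals the constant −sin θ₀·(o_x − x₀ − Δx·cos θ₀ + Δy·sin θ₀) + cos θ₀·(o_y − y₀ − Δx·sin θ₀ − Δy·cos θ₀); in particular this quantity does not depend on t. -/
/-- Where a differentiable curve `(u, v)` is off the line `u = 0`, the squared radius times the
derivative of the polar angle is the cross product of position and velocity. -/
theorem HasDerivAt.sq_add_sq_mul_deriv_arctan_div {u v : ℝ → ℝ} {u' v' t : ℝ}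
    (hu : HasDerivAt u u' t) (hv : HasDerivAt v v' t) (h0 : u t ≠ 0) :
    (u t ^ 2 + v t ^ 2) * _root_.deriv (fun s => Real.arctan (v s / u s)) t =
      v' * u t - v t * u' := by
  rw [(hv.fun_div hu h0).arctan.deriv]
  have : u t ^ 2 + v t ^ 2 ≠ 0 := by positivity
  field_simp

theorem relative_angle_deriv_straight
    (x0 y0 th0 Dx Dy ox oy tmax : ℝ) (htmax : 0 < tmax)
    (xtil ytil Phi : ℝ → ℝ)
    (hx : ∀ t, xtil t = x0 + t * Real.cos th0 + Dx * Real.cos th0 - Dy * Real.sin th0)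
    (hy : ∀ t, ytil t = y0 + t * Real.sin th0 + Dx * Real.sin th0 + Dy * Real.cos th0)
    (hPhi : ∀ t, Phi t = Real.arctan ((oy - ytil t) / (ox - xtil t)) - th0)
    (hne : ∀ t ∈ Set.Icc (0:ℝ) tmax, ox ≠ xtil t) :
    ∀ t ∈ Set.Ioo (0:ℝ) tmax,
      ((ox - xtil t) ^ 2 + (oy - ytil t) ^ 2) * deriv Phi t =
        -Real.sin th0 * (ox - x0 - Dx * Real.cos th0 + Dy * Real.sin th0)
          + Real.cos th0 * (oy - y0 - Dx * Real.sin th0 - Dy * Real.cos th0) := by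
  intro t ht
  have hu : HasDerivAt (fun s => ox - xtil s) (-Real.cos th0) t := by
    simpa [hx] using
      (((((hasDerivAt_id t).mul_const (Real.cos th0)).const_add x0).add_const
        (Dx * Real.cos th0)).sub_const (Dy * Real.sin th0)).const_sub ox
  have hv : HasDerivAt (fun s => oy - ytil s) (-Real.sin th0) t := by
    simpa [hy] using
      (((((hasDerivAt_id t).mul_const (Real.sin th0)).const_add y0).add_const
        (Dx * Real.sin th0)).add_const (Dy * Real.cos th0)).const_sub oy
  have h0 : ox - xtil t ≠ 0 := sub_ne_zero.mpr (hne t (Set.Ioo_subset_Icc_self ht))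
  rw [funext hPhi, deriv_sub_const, hu.sq_add_sq_mul_deriv_arctan_div hv h0, hx, hy]
  ring
end

section
/- (Relative Angle Monotonicity, Straight) If the robot path is a straight path, then the relative angle function Φ is monotonic on [0, t_max]: either Φ is monotone nondecreasing on [0, t_max] or Φ is monotone nonincreasing on [0, t_max]. In particular, for every t in [0, t_max], Φ(t) lies between min{Φ(0), Φ(t_max)} and max{Φ(0), Φ(t_max)}. -/
theorem mul_pos_of_affine_ne_zero {b c : ℝ} {s t : ℝ} (hst : s ≤ t)
    (hne : ∀ u ∈ Set.Icc s t, b - u * c ≠ 0) : 0 < (b - s * c) * (b - t * c) := by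
  have hs := hne s ⟨le_rfl, hst⟩
  by_contra! h
  have hc : c ≠ 0 := by
    rintro rfl
    simp only [mul_zero, sub_zero] at h hs
    exact hs (mul_self_eq_zero.mp (le_antisymm h (mul_self_nonneg b)))
  have hroot : b - b / c * c = 0 := by rw [div_mul_cancel₀ b hc, sub_self]
  have hc2 : 0 < c ^ 2 := by positivity
  have hprod : (b / c - s) * (b / c - t) ≤ 0 := by
    have heq : (b - s * c) * (b - t * c) = (b / c - s) * (b / c - t) * c ^ 2 := by
      field_simp
    rw [heq] at h
    exact nonpos_of_mul_nonpos_left h hc2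
  refine hne (b / c) ⟨?_, ?_⟩ hroot
  · by_contra! hlt
    nlinarith [mul_pos (sub_pos.mpr hlt) (sub_pos.mpr (hlt.trans_le hst))]
  · by_contra! hlt
    nlinarith [mul_pos (sub_pos.mpr hlt) (sub_pos.mpr (hst.trans_lt hlt))]

theorem div_affine_sub_div_affine {a b c d s t : ℝ} (hs : b - s * c ≠ 0) (ht : b - t * c ≠ 0) :
    (a - t * d) / (b - t * c) - (a - s * d) / (b - s * c) =
      (t - s) * (a * c - b * d) / ((b - s * c) * (b - t * c)) := by
  rw [div_sub_div _ _ ht hs, mul_comm (b - t * c) (b - s * c)]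
  congr 1
  ring

theorem monotoneOn_or_antitoneOn_div_affine (a d : ℝ) {b c p q : ℝ}
    (hne : ∀ u ∈ Set.Icc p q, b - u * c ≠ 0) :
    MonotoneOn (fun t => (a - t * d) / (b - t * c)) (Set.Icc p q) ∨
      AntitoneOn (fun t => (a - t * d) / (b - t * c)) (Set.Icc p q) := by
  have hpos : ∀ s ∈ Set.Icc p q, ∀ t ∈ Set.Icc p q, s ≤ t →
      0 < (b - s * c) * (b - t * c) := fun s hs t ht hst =>
    mul_pos_of_affine_ne_zero hst fun u hu => hne u ⟨hs.1.trans hu.1, hu.2.trans ht.2⟩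
  rcases le_total 0 (a * c - b * d) with hk | hk
  · refine Or.inl fun s hs t ht hst => sub_nonneg.mp ?_
    rw [div_affine_sub_div_affine (hne s hs) (hne t ht)]
    exact div_nonneg (mul_nonneg (sub_nonneg.mpr hst) hk) (hpos s hs t ht hst).le
  · refine Or.inr fun s hs t ht hst => sub_nonpos.mp ?_
    rw [div_affine_sub_div_affine (hne s hs) (hne t ht)]
    exact div_nonpos_of_nonpos_of_nonneg
      (mul_nonpos_of_nonneg_of_nonpos (sub_nonneg.mpr hst) hk) (hpos s hs t ht hst).le

theorem relative_angle_monotone_straight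
    (x0 y0 th0 Dx Dy ox oy tmax : ℝ) (htmax : 0 < tmax)
    (xtil ytil Phi : ℝ → ℝ)
    (hx : ∀ t, xtil t = x0 + t * Real.cos th0 + Dx * Real.cos th0 - Dy * Real.sin th0)
    (hy : ∀ t, ytil t = y0 + t * Real.sin th0 + Dx * Real.sin th0 + Dy * Real.cos th0)
    (hPhi : ∀ t, Phi t = Real.arctan ((oy - ytil t) / (ox - xtil t)) - th0)
    (hne : ∀ t ∈ Set.Icc (0:ℝ) tmax, ox ≠ xtil t) :
    (MonotoneOn Phi (Set.Icc 0 tmax) ∨ AntitoneOn Phi (Set.Icc 0 tmax)) ∧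
      ∀ t ∈ Set.Icc (0:ℝ) tmax,
        min (Phi 0) (Phi tmax) ≤ Phi t ∧ Phi t ≤ max (Phi 0) (Phi tmax) := by
  have hden : ∀ t, ox - xtil t = (ox - xtil 0) - t * Real.cos th0 := fun t => by
    rw [hx t, hx 0]; ring
  have hnum : ∀ t, oy - ytil t = (oy - ytil 0) - t * Real.sin th0 := fun t => by
    rw [hy t, hy 0]; ring
  have hmono : MonotoneOn Phi (Set.Icc 0 tmax) ∨ AntitoneOn Phi (Set.Icc 0 tmax) := by
    have hPhi' : Phi = fun t => Real.arctan (((oy - ytil 0) - t * Real.sin th0) /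
        ((ox - xtil 0) - t * Real.cos th0)) - th0 := by
      funext t
      rw [hPhi, hden t, hnum t]
    have hne' : ∀ u ∈ Set.Icc 0 tmax, (ox - xtil 0) - u * Real.cos th0 ≠ 0 := fun u hu => by
      rw [← hden u]
      exact sub_ne_zero.mpr (hne u hu)
    rw [hPhi']
    refine (monotoneOn_or_antitoneOn_div_affine (oy - ytil 0) (Real.sin th0) hne').imp ?_ ?_ <;>
      exact fun h s hs t ht hst =>
        sub_le_sub_right (Real.arctan_strictMono.monotone (h hs ht hst)) th0
  refine ⟨hmono, fun t ht => ?_⟩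
  have h0 : (0 : ℝ) ∈ Set.Icc 0 tmax := ⟨le_rfl, htmax.le⟩
  have h1 : tmax ∈ Set.Icc 0 tmax := ⟨htmax.le, le_rfl⟩
  rcases hmono with h | h
  · exact ⟨min_le_of_left_le (h h0 ht ht.1), le_max_of_le_right (h ht h1 ht.2)⟩
  · exact ⟨min_le_of_right_le (h ht h1 ht.2), le_max_of_le_left (h h0 ht ht.1)⟩
end

section
/- For every t in the open interval (0, t_max), the quantity ((o_x − x̃(t))² + (o_y − ỹ(t))²)·Φ′(t) equals A² + B² − C·cos(t − θ₀) − D·sin(t − θ₀). -/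
/-- The derivative of the angle `arctan (v / u)` of a moving vector `(u, v)`, away from `u = 0`. -/
theorem HasDerivAt.arctan_div {u v : ℝ → ℝ} {u' v' t : ℝ} (hu : HasDerivAt u u' t)
    (hv : HasDerivAt v v' t) (h0 : u t ≠ 0) :
    HasDerivAt (fun s => Real.arctan (v s / u s))
      ((v' * u t - v t * u') / (u t ^ 2 + v t ^ 2)) t := by
  have hpos : 0 < u t ^ 2 + v t ^ 2 := by positivity
  refine (hv.div hu h0).arctan.congr_deriv ?_
  simp only [Pi.div_apply]
  field_simp

theorem relative_angle_deriv_FR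
    (x0 y0 th0 Dx Dy ox oy R tmax A B C D : ℝ)
    (hR : 0 < R) (htmax : 0 < tmax)
    (xtil ytil Phi : ℝ → ℝ)
    (hx : ∀ t, xtil t = x0 + R * Real.sin th0 - (R + Dy) * Real.sin (th0 - t)
      + Dx * Real.cos (th0 - t))
    (hy : ∀ t, ytil t = y0 - R * Real.cos th0 + (R + Dy) * Real.cos (th0 - t)
      + Dx * Real.sin (th0 - t))
    (hPhi : ∀ t, Phi t = Real.arctan ((oy - ytil t) / (ox - xtil t)) - (th0 - t))
    (hA : A = ox - x0 - R * Real.sin th0)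
    (hB : B = oy - y0 + R * Real.cos th0)
    (hC : C = A * Dx + B * R + B * Dy)
    (hD : D = A * R + A * Dy - B * Dx)
    (hne : ∀ t ∈ Set.Icc (0:ℝ) tmax, ox ≠ xtil t) :
    ∀ t ∈ Set.Ioo (0:ℝ) tmax,
      ((ox - xtil t) ^ 2 + (oy - ytil t) ^ 2) * deriv Phi t =
        A ^ 2 + B ^ 2 - C * Real.cos (t - th0) - D * Real.sin (t - th0) := by
  intro t ht
  have h0 : ox - xtil t ≠ 0 := sub_ne_zero.mpr (hne t (Set.Ioo_subset_Icc_self ht))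
  have hpos : 0 < (ox - xtil t) ^ 2 + (oy - ytil t) ^ 2 := by positivity
  have hφ : HasDerivAt (fun s : ℝ => th0 - s) (-1) t := (hasDerivAt_id t).const_sub th0
  have hu : HasDerivAt (fun s => ox - xtil s) (oy - ytil t - B) t := by
    rw [funext hx]
    refine ((((hφ.sin.const_mul (R + Dy)).const_sub (x0 + R * Real.sin th0)).add
      (hφ.cos.const_mul Dx)).const_sub ox).congr_deriv ?_
    rw [hy, hB]
    ring
  have hv : HasDerivAt (fun s => oy - ytil s) (A - (ox - xtil t)) t := by
    rw [funext hy]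
    refine ((((hφ.cos.const_mul (R + Dy)).const_add (y0 - R * Real.cos th0)).add
      (hφ.sin.const_mul Dx)).const_sub oy).congr_deriv ?_
    rw [hx, hA]
    ring
  have hderiv := ((hu.arctan_div hv h0).sub hφ).congr_of_eventuallyEq (.of_forall hPhi)
  have hcos : Real.cos (t - th0) = Real.cos (th0 - t) := by rw [← Real.cos_neg, neg_sub]
  have hsin : Real.sin (t - th0) = -Real.sin (th0 - t) := by rw [← Real.sin_neg, neg_sub]
  rw [hderiv.deriv, mul_sub, mul_div_cancel₀ _ hpos.ne', hcos, hsin, hx, hy, hC, hD, hA, hB]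
  ring
end

section
/- (Relative Angle Monotonicity, F-R) If A² + B² > C·cos(t − θ₀) + D·sin(t − θ₀) for all t in (0, t_max), then Φ is strictly increasing on [0, t_max]; if A² + B² < C·cos(t − θ₀) + D·sin(t − θ₀) for all t in (0, t_max), then Φ is strictly decreasing on [0, t_max]. In either case Φ is monotonic, so for every t in [0, t_max], Φ(t) lies between Φ(0) and Φ(t_max). -/
theorem relative_angle_monotone_FR
    (x0 y0 th0 Dx Dy ox oy R tmax A B C D : ℝ)
    (hR : 0 < R) (htmax : 0 < tmax)
    (xtil ytil Phi : ℝ → ℝ)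
    (hx : ∀ t, xtil t = x0 + R * Real.sin th0 - (R + Dy) * Real.sin (th0 - t)
      + Dx * Real.cos (th0 - t))
    (hy : ∀ t, ytil t = y0 - R * Real.cos th0 + (R + Dy) * Real.cos (th0 - t)
      + Dx * Real.sin (th0 - t))
    (hPhi : ∀ t, Phi t = Real.arctan ((oy - ytil t) / (ox - xtil t)) - (th0 - t))
    (hA : A = ox - x0 - R * Real.sin th0)
    (hB : B = oy - y0 + R * Real.cos th0)
    (hC : C = A * Dx + B * R + B * Dy)
    (hD : D = A * R + A * Dy - B * Dx)
    (hne : ∀ t ∈ Set.Icc (0:ℝ) tmax, ox ≠ xtil t) :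
    ((∀ t ∈ Set.Ioo (0:ℝ) tmax,
        A ^ 2 + B ^ 2 > C * Real.cos (t - th0) + D * Real.sin (t - th0)) →
      StrictMonoOn Phi (Set.Icc 0 tmax)) ∧
    ((∀ t ∈ Set.Ioo (0:ℝ) tmax,
        A ^ 2 + B ^ 2 < C * Real.cos (t - th0) + D * Real.sin (t - th0)) →
      StrictAntiOn Phi (Set.Icc 0 tmax)) ∧
    (((∀ t ∈ Set.Ioo (0:ℝ) tmax,
        A ^ 2 + B ^ 2 > C * Real.cos (t - th0) + D * Real.sin (t - th0)) ∨
      (∀ t ∈ Set.Ioo (0:ℝ) tmax,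
        A ^ 2 + B ^ 2 < C * Real.cos (t - th0) + D * Real.sin (t - th0))) →
      ∀ t ∈ Set.Icc (0:ℝ) tmax,
        min (Phi 0) (Phi tmax) ≤ Phi t ∧ Phi t ≤ max (Phi 0) (Phi tmax)) := by
  have hder : ∀ t ∈ Set.Icc (0:ℝ) tmax, HasDerivAt Phi
      ((A ^ 2 + B ^ 2 - (C * Real.cos (t - th0) + D * Real.sin (t - th0))) /
        ((ox - xtil t) ^ 2 + (oy - ytil t) ^ 2)) t := by
    intro t ht
    have hu : ox - xtil t ≠ 0 := sub_ne_zero.mpr (hne t ht)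
    have hth : HasDerivAt (fun t : ℝ => th0 - t) (-1) t := (hasDerivAt_id t).const_sub th0
    have hxd : HasDerivAt xtil
        ((R + Dy) * Real.cos (th0 - t) + Dx * Real.sin (th0 - t)) t := by
      rw [funext hx]
      refine HasDerivAt.congr_deriv (((hth.sin.const_mul (R + Dy)).const_sub (x0 + R * Real.sin th0)).add
        (hth.cos.const_mul Dx)) ?_
      ring
    have hyd : HasDerivAt ytil
        ((R + Dy) * Real.sin (th0 - t) - Dx * Real.cos (th0 - t)) t := by
      rw [funext hy]
      refine HasDerivAt.congr_deriv (((hth.cos.const_mul (R + Dy)).const_add (y0 - R * Real.cos th0)).add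
        (hth.sin.const_mul Dx)) ?_
      ring
    rw [funext hPhi]
    refine HasDerivAt.congr_deriv (((hyd.const_sub oy).div (hxd.const_sub ox) hu).arctan.sub hth) ?_
    have hcos : Real.cos (t - th0) = Real.cos (th0 - t) := by
      rw [← Real.cos_neg, neg_sub]
    have hsin : Real.sin (t - th0) = -Real.sin (th0 - t) := by
      rw [← Real.sin_neg, neg_sub]
    have hxu : A + (R + Dy) * Real.sin (th0 - t) - Dx * Real.cos (th0 - t) = ox - xtil t := by
      rw [hx, hA]; ring
    have hyv : B - (R + Dy) * Real.cos (th0 - t) - Dx * Real.sin (th0 - t) = oy - ytil t := by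
      rw [hy, hB]; ring
    have hnum : A ^ 2 + B ^ 2 - (C * Real.cos (t - th0) + D * Real.sin (t - th0)) =
        A * (ox - xtil t) + B * (oy - ytil t) := by
      rw [hcos, hsin, ← hxu, ← hyv, hC, hD]; ring
    have hxd' : (R + Dy) * Real.cos (th0 - t) + Dx * Real.sin (th0 - t) = B - (oy - ytil t) := by
      linarith
    have hyd' : (R + Dy) * Real.sin (th0 - t) - Dx * Real.cos (th0 - t) = (ox - xtil t) - A := by
      linarith
    rw [hnum, hxd', hyd']
    simp only [Pi.div_apply]
    generalize ox - xtil t = u at hu ⊢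
    generalize oy - ytil t = v
    have huv : u ^ 2 + v ^ 2 ≠ 0 := by positivity
    field_simp
    ring
  have hcont : ContinuousOn Phi (Set.Icc 0 tmax) := fun t ht =>
    (hder t ht).continuousAt.continuousWithinAt
  have hden : ∀ t ∈ Set.Icc (0:ℝ) tmax, 0 < (ox - xtil t) ^ 2 + (oy - ytil t) ^ 2 := by
    intro t ht
    have hu : ox - xtil t ≠ 0 := sub_ne_zero.mpr (hne t ht)
    positivity
  have hmono : (∀ t ∈ Set.Ioo (0:ℝ) tmax,
      A ^ 2 + B ^ 2 > C * Real.cos (t - th0) + D * Real.sin (t - th0)) →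
      StrictMonoOn Phi (Set.Icc 0 tmax) := by
    intro h
    refine strictMonoOn_of_deriv_pos (convex_Icc 0 tmax) hcont fun t ht => ?_
    rw [interior_Icc] at ht
    have ht' := Set.Ioo_subset_Icc_self ht
    rw [(hder t ht').deriv]
    exact div_pos (sub_pos.mpr (h t ht)) (hden t ht')
  have hanti : (∀ t ∈ Set.Ioo (0:ℝ) tmax,
      A ^ 2 + B ^ 2 < C * Real.cos (t - th0) + D * Real.sin (t - th0)) →
      StrictAntiOn Phi (Set.Icc 0 tmax) := by
    intro h
    refine strictAntiOn_of_deriv_neg (convex_Icc 0 tmax) hcont fun t ht => ?_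
    rw [interior_Icc] at ht
    have ht' := Set.Ioo_subset_Icc_self ht
    rw [(hder t ht').deriv]
    exact div_neg_of_neg_of_pos (sub_neg.mpr (h t ht)) (hden t ht')
  refine ⟨hmono, hanti, fun h t ht => ?_⟩
  have h0 : (0:ℝ) ∈ Set.Icc 0 tmax := Set.left_mem_Icc.mpr htmax.le
  have h1 : tmax ∈ Set.Icc 0 tmax := Set.right_mem_Icc.mpr htmax.le
  rcases h with h | h
  · have hm := (hmono h).monotoneOn
    exact ⟨min_le_of_left_le (hm h0 ht ht.1), le_max_of_le_right (hm ht h1 ht.2)⟩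
  · have hm := (hanti h).antitoneOn
    exact ⟨min_le_of_right_le (hm ht h1 ht.2), le_max_of_le_left (hm h0 ht ht.1)⟩
end

section
/- For every t in the open interval (0, t_max), the quantity ((o_x − x̃(t))² + (o_y − ỹ(t))²)·Φ′(t) equals C·cos(θ₀ + t) + D·sin(θ₀ + t) − A² − B². -/
theorem relative_angle_deriv_FL
    (x0 y0 th0 Dx Dy ox oy R tmax A B C D : ℝ)
    (hR : 0 < R) (htmax : 0 < tmax)
    (xtil ytil Phi : ℝ → ℝ)
    (hx : ∀ t, xtil t = x0 - R * Real.sin th0 + (R - Dy) * Real.sin (th0 + t)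
      + Dx * Real.cos (th0 + t))
    (hy : ∀ t, ytil t = y0 - R * Real.cos th0 - (R - Dy) * Real.cos (th0 + t)
      + Dx * Real.sin (th0 + t))
    (hPhi : ∀ t, Phi t = Real.arctan ((oy - ytil t) / (ox - xtil t)) - (th0 + t))
    (hA : A = ox - x0 + R * Real.sin th0)
    (hB : B = oy - y0 + R * Real.cos th0)
    (hC : C = A * Dx - B * R + B * Dy)
    (hD : D = A * R - A * Dy + B * Dx)
    (hne : ∀ t ∈ Set.Icc (0:ℝ) tmax, ox ≠ xtil t) :
    ∀ t ∈ Set.Ioo (0:ℝ) tmax,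
      ((ox - xtil t) ^ 2 + (oy - ytil t) ^ 2) * deriv Phi t =
        C * Real.cos (th0 + t) + D * Real.sin (th0 + t) - A ^ 2 - B ^ 2 := by
  intro t ht
  have hu : ox - xtil t ≠ 0 := sub_ne_zero.mpr (hne t (Set.Ioo_subset_Icc_self ht))
  have hth : HasDerivAt (fun s : ℝ => th0 + s) 1 t := (hasDerivAt_id t).const_add th0
  have hu' : HasDerivAt (fun s => ox - xtil s) (B - (oy - ytil t)) t := by
    rw [funext hx]
    refine ((((hth.sin.const_mul (R - Dy)).const_add (x0 - R * Real.sin th0)).add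
      (hth.cos.const_mul Dx)).const_sub ox).congr_deriv ?_
    rw [hy, hB]
    ring
  have hv' : HasDerivAt (fun s => oy - ytil s) (ox - xtil t - A) t := by
    rw [funext hy]
    refine ((((hth.cos.const_mul (R - Dy)).const_sub (y0 - R * Real.cos th0)).add
      (hth.sin.const_mul Dx)).const_sub oy).congr_deriv ?_
    rw [hx, hA]
    ring
  have hderiv := ((hv'.div hu' hu).arctan.sub hth).deriv
  have hPhi' : Phi = fun s => Real.arctan ((oy - ytil s) / (ox - xtil s)) - (th0 + s) :=
    funext hPhi
  have hmul : ((ox - xtil t) ^ 2 + (oy - ytil t) ^ 2) * deriv Phi t =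
      -A * (ox - xtil t) - B * (oy - ytil t) := by
    rw [hPhi']
    refine (congrArg _ hderiv).trans ?_
    have hsum : (ox - xtil t) ^ 2 + (oy - ytil t) ^ 2 ≠ 0 := by positivity
    simp only [Pi.div_apply]
    field_simp
    ring
  rw [hmul, hx, hy, hC, hD, hA, hB]
  ring
end

section
/- (Relative Angle Monotonicity, F-L) If A² + B² < C·cos(θ₀ + t) + D·sin(θ₀ + t) for all t in (0, t_max), then Φ is strictly increasing on [0, t_max]; if A² + B² > C·cos(θ₀ + t) + D·sin(θ₀ + t) for all t in (0, t_max), then Φ is strictly decreasing on [0, t_max]. In either case Φ is monotonic, so for every t in [0, t_max], Φ(t) lies between Φ(0) and Φ(t_max). -/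
/-- The derivative of `arctan (Y / X) - (θ₀ + t)` when `(X, Y)` rotates about `(A, B)` at unit
angular speed. -/
theorem hasDerivAt_arctan_div_sub_angle {X Y : ℝ → ℝ} {A B θ₀ t : ℝ}
    (hX : HasDerivAt X (B - Y t) t) (hY : HasDerivAt Y (X t - A) t) (h0 : X t ≠ 0) :
    HasDerivAt (fun s => Real.arctan (Y s / X s) - (θ₀ + s))
      (-(A * X t + B * Y t) / (X t ^ 2 + Y t ^ 2)) t := by
  have h := (hY.div hX h0).arctan.sub ((hasDerivAt_id t).const_add θ₀)
  refine h.congr_deriv ?_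
  have hpos : X t ^ 2 + Y t ^ 2 ≠ 0 := by positivity
  have hpos' : 1 + (Y t / X t) ^ 2 ≠ 0 := by positivity
  simp only [Pi.div_apply]
  field_simp
  ring


theorem relative_angle_monotone_FL
    (x0 y0 th0 Dx Dy ox oy R tmax A B C D : ℝ)
    (hR : 0 < R) (htmax : 0 < tmax)
    (xtil ytil Phi : ℝ → ℝ)
    (hx : ∀ t, xtil t = x0 - R * Real.sin th0 + (R - Dy) * Real.sin (th0 + t)
      + Dx * Real.cos (th0 + t))
    (hy : ∀ t, ytil t = y0 - R * Real.cos th0 - (R - Dy) * Real.cos (th0 + t)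
      + Dx * Real.sin (th0 + t))
    (hPhi : ∀ t, Phi t = Real.arctan ((oy - ytil t) / (ox - xtil t)) - (th0 + t))
    (hA : A = ox - x0 + R * Real.sin th0)
    (hB : B = oy - y0 + R * Real.cos th0)
    (hC : C = A * Dx - B * R + B * Dy)
    (hD : D = A * R - A * Dy + B * Dx)
    (hne : ∀ t ∈ Set.Icc (0:ℝ) tmax, ox ≠ xtil t) :
    ((∀ t ∈ Set.Ioo (0:ℝ) tmax,
        A ^ 2 + B ^ 2 < C * Real.cos (th0 + t) + D * Real.sin (th0 + t)) →
      StrictMonoOn Phi (Set.Icc 0 tmax)) ∧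
    ((∀ t ∈ Set.Ioo (0:ℝ) tmax,
        A ^ 2 + B ^ 2 > C * Real.cos (th0 + t) + D * Real.sin (th0 + t)) →
      StrictAntiOn Phi (Set.Icc 0 tmax)) ∧
    (((∀ t ∈ Set.Ioo (0:ℝ) tmax,
        A ^ 2 + B ^ 2 < C * Real.cos (th0 + t) + D * Real.sin (th0 + t)) ∨
      (∀ t ∈ Set.Ioo (0:ℝ) tmax,
        A ^ 2 + B ^ 2 > C * Real.cos (th0 + t) + D * Real.sin (th0 + t))) →
      ∀ t ∈ Set.Icc (0:ℝ) tmax,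
        min (Phi 0) (Phi tmax) ≤ Phi t ∧ Phi t ≤ max (Phi 0) (Phi tmax)) := by
  have hXd (t : ℝ) : HasDerivAt (fun s => ox - xtil s) (B - (oy - ytil t)) t := by
    have hs := ((hasDerivAt_id t).const_add th0).sin
    have hc := ((hasDerivAt_id t).const_add th0).cos
    have h := (((hs.const_mul (R - Dy)).const_add (x0 - R * Real.sin th0)).add
      (hc.const_mul Dx)).const_sub ox
    rw [funext hx]
    refine h.congr_deriv ?_
    rw [hy, hB]
    simp only [id]
    ring
  have hYd (t : ℝ) : HasDerivAt (fun s => oy - ytil s) (ox - xtil t - A) t := by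
    have hs := ((hasDerivAt_id t).const_add th0).sin
    have hc := ((hasDerivAt_id t).const_add th0).cos
    have h := (((hc.const_mul (R - Dy)).const_sub (y0 - R * Real.cos th0)).add
      (hs.const_mul Dx)).const_sub oy
    rw [funext hy]
    refine h.congr_deriv ?_
    rw [hx, hA]
    simp only [id]
    ring
  have hPd (t : ℝ) (ht : t ∈ Set.Icc 0 tmax) : HasDerivAt Phi
      (-(A * (ox - xtil t) + B * (oy - ytil t)) /
        ((ox - xtil t) ^ 2 + (oy - ytil t) ^ 2)) t := by
    rw [funext hPhi]
    exact hasDerivAt_arctan_div_sub_angle (hXd t) (hYd t) (sub_ne_zero.2 (hne t ht))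
  have hnum (t : ℝ) : A * (ox - xtil t) + B * (oy - ytil t) =
      A ^ 2 + B ^ 2 - (C * Real.cos (th0 + t) + D * Real.sin (th0 + t)) := by
    rw [hx, hy, hC, hD, hA, hB]
    ring
  have hden (t : ℝ) (ht : t ∈ Set.Icc 0 tmax) :
      0 < (ox - xtil t) ^ 2 + (oy - ytil t) ^ 2 := by
    have := sub_ne_zero.2 (hne t ht)
    positivity
  have hcont : ContinuousOn Phi (Set.Icc 0 tmax) :=
    fun t ht => (hPd t ht).continuousAt.continuousWithinAt
  have hmono (h : ∀ t ∈ Set.Ioo (0:ℝ) tmax,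
      A ^ 2 + B ^ 2 < C * Real.cos (th0 + t) + D * Real.sin (th0 + t)) :
      StrictMonoOn Phi (Set.Icc 0 tmax) := by
    refine strictMonoOn_of_deriv_pos (convex_Icc 0 tmax) hcont fun t ht => ?_
    rw [interior_Icc] at ht
    have ht' := Set.Ioo_subset_Icc_self ht
    rw [(hPd t ht').deriv, hnum]
    exact div_pos (by linarith [h t ht]) (hden t ht')
  have hanti (h : ∀ t ∈ Set.Ioo (0:ℝ) tmax,
      A ^ 2 + B ^ 2 > C * Real.cos (th0 + t) + D * Real.sin (th0 + t)) :
      StrictAntiOn Phi (Set.Icc 0 tmax) := by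
    refine strictAntiOn_of_deriv_neg (convex_Icc 0 tmax) hcont fun t ht => ?_
    rw [interior_Icc] at ht
    have ht' := Set.Ioo_subset_Icc_self ht
    rw [(hPd t ht').deriv, hnum]
    exact div_neg_of_neg_of_pos (by linarith [h t ht]) (hden t ht')
  have h0 : (0 : ℝ) ∈ Set.Icc 0 tmax := Set.left_mem_Icc.2 htmax.le
  have h1 : tmax ∈ Set.Icc 0 tmax := Set.right_mem_Icc.2 htmax.le
  refine ⟨hmono, hanti, ?_⟩
  rintro (h | h) t ht
  · have hm := (hmono h).monotoneOn
    exact ⟨min_le_of_left_le (hm h0 ht ht.1), le_max_of_le_right (hm ht h1 ht.2)⟩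
  · have hm := (hanti h).antitoneOn
    exact ⟨min_le_of_right_le (hm ht h1 ht.2), le_max_of_le_left (hm h0 ht ht.1)⟩
end

section
/- (Relative Angle Monotonicity, B-L) If A² + B² > C·cos(t − θ₀) + D·sin(t − θ₀) for all t in (−t_max, 0), or A² + B² < C·cos(t − θ₀) + D·sin(t − θ₀) for all t in (−t_max, 0), then Φ is strictly monotonic (strictly increasing in the first case, strictly decreasing in the second) on [−t_max, 0]; in particular for every t in [−t_max, 0], Φ(t) lies between Φ(−t_max) and Φ(0). -/
/-- The derivative of the relative angle at a point where the abscissa difference is nonzero. -/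
theorem hasDerivAt_relative_angle (A B P Q th0 t : ℝ)
    (hu : A + P * Real.sin (th0 - t) - Q * Real.cos (th0 - t) ≠ 0) :
    HasDerivAt (fun t => Real.arctan ((B - P * Real.cos (th0 - t) - Q * Real.sin (th0 - t)) /
        (A + P * Real.sin (th0 - t) - Q * Real.cos (th0 - t))) - (th0 - t))
      ((A ^ 2 + B ^ 2 -
          ((A * Q + B * P) * Real.cos (t - th0) + (A * P - B * Q) * Real.sin (t - th0))) /
        ((A + P * Real.sin (th0 - t) - Q * Real.cos (th0 - t)) ^ 2 +
          (B - P * Real.cos (th0 - t) - Q * Real.sin (th0 - t)) ^ 2)) t := by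
  have hl : HasDerivAt (fun t : ℝ => th0 - t) (-1) t := (hasDerivAt_id t).const_sub th0
  have hu' := ((hl.sin.const_mul P).const_add A).sub (hl.cos.const_mul Q)
  have hv' := ((hl.cos.const_mul P).const_sub B).sub (hl.sin.const_mul Q)
  have h := ((hv'.div hu' hu).arctan).sub hl
  refine h.congr_deriv ?_
  have hc : Real.cos (t - th0) = Real.cos (th0 - t) := by rw [← Real.cos_neg, neg_sub]
  have hs : Real.sin (t - th0) = -Real.sin (th0 - t) := by rw [← Real.sin_neg, neg_sub]
  rw [hc, hs]
  simp only [Pi.sub_apply, Pi.div_apply]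
  generalize Real.sin (th0 - t) = s at *
  generalize Real.cos (th0 - t) = c at *
  have hw : (A + P * s - Q * c) ^ 2 + (B - P * c - Q * s) ^ 2 ≠ 0 := by positivity
  have e : 1 + ((B - P * c - Q * s) / (A + P * s - Q * c)) ^ 2 =
      ((A + P * s - Q * c) ^ 2 + (B - P * c - Q * s) ^ 2) / (A + P * s - Q * c) ^ 2 := by
    rw [div_pow, add_div, div_self (pow_ne_zero 2 hu)]
  rw [e]
  field_simp
  ring

theorem relative_angle_monotone_BL
    (x0 y0 th0 Dx Dy ox oy R tmax A B C D : ℝ)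
    (hR : 0 < R) (htmax : 0 < tmax)
    (xtil ytil Phi : ℝ → ℝ)
    (hx : ∀ t, xtil t = x0 + R * Real.sin th0 - (R + Dy) * Real.sin (th0 - t)
      + Dx * Real.cos (th0 - t))
    (hy : ∀ t, ytil t = y0 - R * Real.cos th0 + (R + Dy) * Real.cos (th0 - t)
      + Dx * Real.sin (th0 - t))
    (hPhi : ∀ t, Phi t = Real.arctan ((oy - ytil t) / (ox - xtil t)) - (th0 - t))
    (hA : A = ox - x0 - R * Real.sin th0)
    (hB : B = oy - y0 + R * Real.cos th0)
    (hC : C = A * Dx + B * R + B * Dy)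
    (hD : D = A * R + A * Dy - B * Dx)
    (hne : ∀ t ∈ Set.Icc (-tmax) (0:ℝ), ox ≠ xtil t) :
    ((∀ t ∈ Set.Ioo (-tmax) (0:ℝ),
        A ^ 2 + B ^ 2 > C * Real.cos (t - th0) + D * Real.sin (t - th0)) →
      StrictMonoOn Phi (Set.Icc (-tmax) 0)) ∧
    ((∀ t ∈ Set.Ioo (-tmax) (0:ℝ),
        A ^ 2 + B ^ 2 < C * Real.cos (t - th0) + D * Real.sin (t - th0)) →
      StrictAntiOn Phi (Set.Icc (-tmax) 0)) ∧
    (((∀ t ∈ Set.Ioo (-tmax) (0:ℝ),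
        A ^ 2 + B ^ 2 > C * Real.cos (t - th0) + D * Real.sin (t - th0)) ∨
      (∀ t ∈ Set.Ioo (-tmax) (0:ℝ),
        A ^ 2 + B ^ 2 < C * Real.cos (t - th0) + D * Real.sin (t - th0))) →
      ∀ t ∈ Set.Icc (-tmax) (0:ℝ),
        min (Phi (-tmax)) (Phi 0) ≤ Phi t ∧ Phi t ≤ max (Phi (-tmax)) (Phi 0)) := by
  have hu : ∀ t, ox - xtil t =
      A + (R + Dy) * Real.sin (th0 - t) - Dx * Real.cos (th0 - t) := by
    intro t; rw [hx, hA]; ring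
  have hv : ∀ t, oy - ytil t =
      B - (R + Dy) * Real.cos (th0 - t) - Dx * Real.sin (th0 - t) := by
    intro t; rw [hy, hB]; ring
  have hC' : C = A * Dx + B * (R + Dy) := by rw [hC]; ring
  have hD' : D = A * (R + Dy) - B * Dx := by rw [hD]; ring
  have hPhi' : Phi = fun t => Real.arctan
      ((B - (R + Dy) * Real.cos (th0 - t) - Dx * Real.sin (th0 - t)) /
        (A + (R + Dy) * Real.sin (th0 - t) - Dx * Real.cos (th0 - t))) - (th0 - t) := by
    funext t; rw [hPhi, hu, hv]
  have hne' : ∀ t ∈ Set.Icc (-tmax) (0 : ℝ),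
      A + (R + Dy) * Real.sin (th0 - t) - Dx * Real.cos (th0 - t) ≠ 0 := by
    intro t ht; rw [← hu]; exact sub_ne_zero.mpr (hne t ht)
  have hderiv : ∀ t ∈ Set.Icc (-tmax) (0 : ℝ), HasDerivAt Phi
      ((A ^ 2 + B ^ 2 - (C * Real.cos (t - th0) + D * Real.sin (t - th0))) /
        ((A + (R + Dy) * Real.sin (th0 - t) - Dx * Real.cos (th0 - t)) ^ 2 +
          (B - (R + Dy) * Real.cos (th0 - t) - Dx * Real.sin (th0 - t)) ^ 2)) t := by
    intro t ht
    rw [hPhi', hC', hD']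
    exact hasDerivAt_relative_angle A B (R + Dy) Dx th0 t (hne' t ht)
  have hcont : ContinuousOn Phi (Set.Icc (-tmax) 0) :=
    fun t ht => (hderiv t ht).continuousAt.continuousWithinAt
  have hpos : ∀ t ∈ Set.Icc (-tmax) (0 : ℝ),
      0 < (A + (R + Dy) * Real.sin (th0 - t) - Dx * Real.cos (th0 - t)) ^ 2 +
          (B - (R + Dy) * Real.cos (th0 - t) - Dx * Real.sin (th0 - t)) ^ 2 := by
    intro t ht
    have := hne' t ht
    positivity
  have hmono : (∀ t ∈ Set.Ioo (-tmax) (0:ℝ),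
        A ^ 2 + B ^ 2 > C * Real.cos (t - th0) + D * Real.sin (t - th0)) →
      StrictMonoOn Phi (Set.Icc (-tmax) 0) := by
    intro h
    refine strictMonoOn_of_deriv_pos (convex_Icc _ _) hcont fun t ht => ?_
    rw [interior_Icc] at ht
    have ht' := Set.Ioo_subset_Icc_self ht
    rw [(hderiv t ht').deriv]
    exact div_pos (sub_pos.mpr (h t ht)) (hpos t ht')
  have hanti : (∀ t ∈ Set.Ioo (-tmax) (0:ℝ),
        A ^ 2 + B ^ 2 < C * Real.cos (t - th0) + D * Real.sin (t - th0)) →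
      StrictAntiOn Phi (Set.Icc (-tmax) 0) := by
    intro h
    refine strictAntiOn_of_deriv_neg (convex_Icc _ _) hcont fun t ht => ?_
    rw [interior_Icc] at ht
    have ht' := Set.Ioo_subset_Icc_self ht
    rw [(hderiv t ht').deriv]
    exact div_neg_of_neg_of_pos (sub_neg.mpr (h t ht)) (hpos t ht')
  refine ⟨hmono, hanti, fun h t ht => ?_⟩
  have hl : -tmax ∈ Set.Icc (-tmax) (0 : ℝ) := Set.left_mem_Icc.mpr (by linarith)
  have hr : (0 : ℝ) ∈ Set.Icc (-tmax) (0 : ℝ) := Set.right_mem_Icc.mpr (by linarith)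
  rcases h with h | h
  · have hm := (hmono h).monotoneOn
    exact ⟨min_le_of_left_le (hm hl ht ht.1), le_max_of_le_right (hm ht hr ht.2)⟩
  · have hm := (hanti h).antitoneOn
    exact ⟨min_le_of_right_le (hm ht hr ht.2), le_max_of_le_left (hm hl ht ht.1)⟩
end

section
/- (Relative Angle Monotonicity, B-R) If A² + B² < C·cos(θ₀ + t) + D·sin(θ₀ + t) for all t in (−t_max, 0), or A² + B² > C·cos(θ₀ + t) + D·sin(θ₀ + t) for all t in (−t_max, 0), then Φ is strictly monotonic (strictly increasing in the first case, strictly decreasing in the second) on [−t_max, 0]; in particular for every t in [−t_max, 0], Φ(t) lies between Φ(−t_max) and Φ(0). -/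
/-- Derivative of the bearing angle of `(u, v)` relative to a heading turning at unit rate, when
`(u, v)` itself rotates about `(A, B)` at unit rate. -/
theorem hasDerivAt_arctan_div_sub_of_rotation {u v : ℝ → ℝ} {A B θ t : ℝ}
    (hu : HasDerivAt u (B - v t) t) (hv : HasDerivAt v (u t - A) t) (h0 : u t ≠ 0) :
    HasDerivAt (fun s => Real.arctan (v s / u s) - (θ + s))
      (-(A * u t + B * v t) / (u t ^ 2 + v t ^ 2)) t := by
  have hpos : 0 < u t ^ 2 + v t ^ 2 := by positivity
  refine ((hv.fun_div hu h0).arctan.sub ((hasDerivAt_id t).const_add θ)).congr_deriv ?_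
  field_simp
  ring

theorem relative_angle_monotone_BR
    (x0 y0 th0 Dx Dy ox oy R tmax A B C D : ℝ)
    (hR : 0 < R) (htmax : 0 < tmax)
    (xtil ytil Phi : ℝ → ℝ)
    (hx : ∀ t, xtil t = x0 - R * Real.sin th0 + (R - Dy) * Real.sin (th0 + t)
      + Dx * Real.cos (th0 + t))
    (hy : ∀ t, ytil t = y0 - R * Real.cos th0 - (R - Dy) * Real.cos (th0 + t)
      + Dx * Real.sin (th0 + t))
    (hPhi : ∀ t, Phi t = Real.arctan ((oy - ytil t) / (ox - xtil t)) - (th0 + t))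
    (hA : A = ox - x0 + R * Real.sin th0)
    (hB : B = oy - y0 + R * Real.cos th0)
    (hC : C = A * Dx - B * R + B * Dy)
    (hD : D = A * R - A * Dy + B * Dx)
    (hne : ∀ t ∈ Set.Icc (-tmax) (0:ℝ), ox ≠ xtil t) :
    ((∀ t ∈ Set.Ioo (-tmax) (0:ℝ),
        A ^ 2 + B ^ 2 < C * Real.cos (th0 + t) + D * Real.sin (th0 + t)) →
      StrictMonoOn Phi (Set.Icc (-tmax) 0)) ∧
    ((∀ t ∈ Set.Ioo (-tmax) (0:ℝ),
        A ^ 2 + B ^ 2 > C * Real.cos (th0 + t) + D * Real.sin (th0 + t)) →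
      StrictAntiOn Phi (Set.Icc (-tmax) 0)) ∧
    (((∀ t ∈ Set.Ioo (-tmax) (0:ℝ),
        A ^ 2 + B ^ 2 < C * Real.cos (th0 + t) + D * Real.sin (th0 + t)) ∨
      (∀ t ∈ Set.Ioo (-tmax) (0:ℝ),
        A ^ 2 + B ^ 2 > C * Real.cos (th0 + t) + D * Real.sin (th0 + t))) →
      ∀ t ∈ Set.Icc (-tmax) (0:ℝ),
        min (Phi (-tmax)) (Phi 0) ≤ Phi t ∧ Phi t ≤ max (Phi (-tmax)) (Phi 0)) := by
  have hu (t : ℝ) : HasDerivAt (fun s => ox - xtil s) (B - (oy - ytil t)) t := by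
    have hθ := (hasDerivAt_id t).const_add th0
    simp only [hx]
    refine ((((hθ.sin.const_mul (R - Dy)).const_add (x0 - R * Real.sin th0)).add
      (hθ.cos.const_mul Dx)).const_sub ox).congr_deriv ?_
    simp only [hy, hB, id]
    ring
  have hv (t : ℝ) : HasDerivAt (fun s => oy - ytil s) (ox - xtil t - A) t := by
    have hθ := (hasDerivAt_id t).const_add th0
    simp only [hy]
    refine ((((hθ.cos.const_mul (R - Dy)).const_sub (y0 - R * Real.cos th0)).add
      (hθ.sin.const_mul Dx)).const_sub oy).congr_deriv ?_
    simp only [hx, hA, id]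
    ring
  have hderiv (t : ℝ) (ht : t ∈ Set.Icc (-tmax) 0) : HasDerivAt Phi
      ((C * Real.cos (th0 + t) + D * Real.sin (th0 + t) - (A ^ 2 + B ^ 2)) /
        ((ox - xtil t) ^ 2 + (oy - ytil t) ^ 2)) t := by
    rw [funext hPhi]
    refine (hasDerivAt_arctan_div_sub_of_rotation (u := fun s => ox - xtil s)
      (v := fun s => oy - ytil s) (hu t) (hv t)
      (sub_ne_zero.mpr (hne t ht))).congr_deriv ?_
    congr 1
    simp only [hx, hy, hC, hD, hA, hB]
    ring
  have hcont : ContinuousOn Phi (Set.Icc (-tmax) 0) :=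
    fun t ht => (hderiv t ht).continuousAt.continuousWithinAt
  have hden (t : ℝ) (ht : t ∈ Set.Icc (-tmax) 0) :
      0 < (ox - xtil t) ^ 2 + (oy - ytil t) ^ 2 := by
    have := sub_ne_zero.mpr (hne t ht)
    positivity
  have hmono (h : ∀ t ∈ Set.Ioo (-tmax) (0:ℝ),
      A ^ 2 + B ^ 2 < C * Real.cos (th0 + t) + D * Real.sin (th0 + t)) :
      StrictMonoOn Phi (Set.Icc (-tmax) 0) := by
    refine strictMonoOn_of_deriv_pos (convex_Icc _ _) hcont fun t ht => ?_
    rw [interior_Icc] at ht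
    have ht' := Set.Ioo_subset_Icc_self ht
    rw [(hderiv t ht').deriv]
    exact div_pos (sub_pos.mpr (h t ht)) (hden t ht')
  have hanti (h : ∀ t ∈ Set.Ioo (-tmax) (0:ℝ),
      A ^ 2 + B ^ 2 > C * Real.cos (th0 + t) + D * Real.sin (th0 + t)) :
      StrictAntiOn Phi (Set.Icc (-tmax) 0) := by
    refine strictAntiOn_of_deriv_neg (convex_Icc _ _) hcont fun t ht => ?_
    rw [interior_Icc] at ht
    have ht' := Set.Ioo_subset_Icc_self ht
    rw [(hderiv t ht').deriv]
    exact div_neg_of_neg_of_pos (sub_neg.mpr (h t ht)) (hden t ht')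
  refine ⟨hmono, hanti, fun h t ht => ?_⟩
  have hl : -tmax ∈ Set.Icc (-tmax) (0:ℝ) := Set.left_mem_Icc.mpr (by linarith)
  have hr : (0:ℝ) ∈ Set.Icc (-tmax) (0:ℝ) := Set.right_mem_Icc.mpr (by linarith)
  rcases h with h | h
  · have hm := (hmono h).monotoneOn
    exact ⟨min_le_of_left_le (hm hl ht ht.1), le_max_of_le_right (hm ht hr ht.2)⟩
  · have hm := (hanti h).antitoneOn
    exact ⟨min_le_of_right_le (hm ht hr ht.2), le_max_of_le_left (hm hl ht ht.1)⟩
end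

section
/- (Tether Length Monotonicity, Straight) Set K = (o_x − x₀)·cos θ₀ + (o_y − y₀)·sin θ₀ − Δx. If K < 0, then the tether length function L is strictly increasing on [0, t_max]; if K > t_max, then L is strictly decreasing on [0, t_max]. In either case L is monotonic, so for every t in [0, t_max], L(t) lies between L(0) and L(t_max). -/
theorem tether_length_monotone_straight
    (x0 y0 th0 Dx Dy ox oy Lo tmax : ℝ) (htmax : 0 < tmax)
    (xtil ytil L : ℝ → ℝ)
    (hx : ∀ t, xtil t = x0 + t * Real.cos th0 + Dx * Real.cos th0 - Dy * Real.sin th0)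
    (hy : ∀ t, ytil t = y0 + t * Real.sin th0 + Dx * Real.sin th0 + Dy * Real.cos th0)
    (hL : ∀ t, L t = Lo + Real.sqrt ((ox - xtil t) ^ 2 + (oy - ytil t) ^ 2))
    (hpos : ∀ t ∈ Set.Icc (0:ℝ) tmax, 0 < (ox - xtil t) ^ 2 + (oy - ytil t) ^ 2)
    (K : ℝ)
    (hK : K = (ox - x0) * Real.cos th0 + (oy - y0) * Real.sin th0 - Dx) :
    (K < 0 → StrictMonoOn L (Set.Icc 0 tmax)) ∧
    (K > tmax → StrictAntiOn L (Set.Icc 0 tmax)) ∧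
    ((K < 0 ∨ K > tmax) →
      ∀ t ∈ Set.Icc (0:ℝ) tmax,
        min (L 0) (L tmax) ≤ L t ∧ L t ≤ max (L 0) (L tmax)) := by
  have hdiff : ∀ a b, ((ox - xtil b) ^ 2 + (oy - ytil b) ^ 2) -
      ((ox - xtil a) ^ 2 + (oy - ytil a) ^ 2) = (b - a) * (b + a - 2 * K) := by
    intro a b
    rw [hx, hx, hy, hy, hK]
    linear_combination ((b ^ 2 - a ^ 2) + 2 * (b - a) * Dx) * Real.sin_sq_add_cos_sq th0
  have hlt : ∀ a b, 0 < (b - a) * (b + a - 2 * K) → L a < L b := by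
    intro a b h
    rw [hL, hL]
    have hsqrt := Real.sqrt_lt_sqrt (add_nonneg (sq_nonneg (ox - xtil a)) (sq_nonneg (oy - ytil a)))
      (show _ < (ox - xtil b) ^ 2 + (oy - ytil b) ^ 2 by linarith [hdiff a b])
    linarith
  have hmono : K < 0 → StrictMonoOn L (Set.Icc 0 tmax) := fun hneg a ha b hb hab =>
    hlt a b (mul_pos (by linarith) (by linarith [ha.1, hb.1]))
  have hanti : K > tmax → StrictAntiOn L (Set.Icc 0 tmax) := fun hgt a ha b hb hab =>
    hlt b a (mul_pos_of_neg_of_neg (by linarith) (by linarith [ha.2, hb.2]))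
  have h0 : (0 : ℝ) ∈ Set.Icc 0 tmax := Set.left_mem_Icc.2 htmax.le
  have h1 : tmax ∈ Set.Icc 0 tmax := Set.right_mem_Icc.2 htmax.le
  refine ⟨hmono, hanti, ?_⟩
  rintro (h | h) t ht
  · have hm := (hmono h).monotoneOn
    exact ⟨min_le_of_left_le (hm h0 ht ht.1), le_max_of_le_right (hm ht h1 ht.2)⟩
  · have hm := (hanti h).antitoneOn
    exact ⟨min_le_of_right_le (hm ht h1 ht.2), le_max_of_le_left (hm h0 ht ht.1)⟩
end
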